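/- Let m ≥ n ≥ 1, let Σμ = diag(λ_{μ,1},…,λ_{μ,m}) and Σν = diag(λ_{ν,1},…,λ_{ν,n}) be diagonal matrices with positive non-increasing diagonal entries, and let μ = N(0,Σμ) on R^m and ν = N(0,Σν) on R^n. Then for every ε > 0, IGW_ε(μ,ν) = tr(Σμ²) + tr(Σν²) − 2 Σ_{k=1}^{n} [λ_{μ,k} λ_{ν,k} − ε/4]^+ + (ε/2) Σ_{k=1}^{n} [log(λ_{μ,k} λ_{ν,k}) − log(ε/4)]^+. Moreover the infimum is attained by the Gaussian coupling π* = N(0, Σ_{π*}), where Σ_{π*} is the block matrix with diagonal blocks Σμ, Σν and off-diagonal block K*_{μν} of size m×n which is diagonal with entries (λ_{μ,k} λ_{ν,k} [1 − ε/(4 λ_{μ,k} λ_{ν,k})]^+)^{1/2} for k = 1,…,n. -/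

import Mathlib

open MeasureTheory Matrix ENNReal

/-- Density (w.r.t. Lebesgue measure) of the centered Gaussian with covariance `S`. -/
noncomputable def gaussianPdf {ι : Type*} [Fintype ι] [DecidableEq ι]
    (S : Matrix ι ι ℝ) (x : ι → ℝ) : ℝ≥0∞ :=
  ENNReal.ofReal (Real.exp (-(x ⬝ᵥ (S⁻¹ *ᵥ x)) / 2) /
    Real.sqrt ((2 * Real.pi) ^ (Fintype.card ι) * S.det))

/-- The centered Gaussian measure `N(0, S)` on `ι → ℝ` with covariance matrix `S`. -/
noncomputable def gaussianMeasure {ι : Type*} [Fintype ι] [DecidableEq ι]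
    (S : Matrix ι ι ℝ) : Measure (ι → ℝ) :=
  MeasureTheory.volume.withDensity (gaussianPdf S)

/-- Generalized Kullback–Leibler divergence between positive measures:
`KL(α‖β) = ∫ log (dα/dβ) dα + β(univ) - α(univ)`.
For probability measures this is the usual Kullback–Leibler divergence. -/
noncomputable def KLgen {X : Type*} [MeasurableSpace X] (α β : Measure X) : ℝ :=
  (∫ x, Real.log ((α.rnDeriv β x).toReal) ∂α) + (β Set.univ).toReal - (α Set.univ).toReal

section WeightedSums

/-- Summation by parts: a nonnegative decreasing weight preserves nonnegativity of partial sums. -/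
lemma mul_sum_le_sum_mul_of_antitone {N : ℕ} (a d : Fin N → ℝ) (c : ℝ) (ha : Antitone a)
    (hc : ∀ i, c ≤ a i) (hd : ∀ r : ℕ, 0 ≤ ∑ i : Fin N, if (i : ℕ) < r then d i else 0) :
    c * ∑ i, d i ≤ ∑ i, a i * d i := by
  induction N generalizing c with
  | zero => simp
  | succ N ih =>
    have htot : 0 ≤ ∑ i, d i := by
      have := hd (N + 1)
      rwa [Finset.sum_congr rfl fun i _ => if_pos i.is_lt] at this
    have key := ih (fun i => a i.castSucc) (fun i => d i.castSucc) (a (Fin.last N))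
      (fun i j hij => ha (by simpa using hij)) (fun i => ha (Fin.le_last _)) (fun r => by
        have h := hd (min r N)
        rw [Fin.sum_univ_castSucc] at h
        simp only [Fin.val_castSucc, lt_min_iff, Fin.is_lt, and_true, Fin.val_last, lt_irrefl,
          and_false, if_false, add_zero] at h
        exact h)
    rw [Fin.sum_univ_castSucc] at htot ⊢
    rw [Fin.sum_univ_castSucc]
    nlinarith [mul_le_mul_of_nonneg_right (hc (Fin.last N)) htot]

lemma sum_mul_le_sum_mul_of_antitone {N : ℕ} (a x y : Fin N → ℝ) (ha : Antitone a)
    (ha0 : ∀ i, 0 ≤ a i)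
    (h : ∀ r : ℕ, (∑ i : Fin N, if (i : ℕ) < r then x i else 0) ≤
      ∑ i : Fin N, if (i : ℕ) < r then y i else 0) :
    ∑ i, a i * x i ≤ ∑ i, a i * y i := by
  have := mul_sum_le_sum_mul_of_antitone a (fun i => y i - x i) 0 ha ha0 (fun r => by
    have h' := sub_nonneg.2 (h r)
    rw [← Finset.sum_sub_distrib] at h'
    refine h'.trans_eq (Finset.sum_congr rfl fun i _ => ?_)
    split_ifs <;> simp)
  simp only [zero_mul, mul_sub, Finset.sum_sub_distrib] at this
  linarith

/-- A `[0,1]`-valued weight of total mass at most `q` puts at most the `q` largest values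
of a decreasing sequence into a weighted sum. -/
lemma sum_mul_weight_le {N : ℕ} (s w : Fin N → ℝ) (hs : Antitone s) (hs0 : ∀ i, 0 ≤ s i) (q : ℕ)
    (hw0 : ∀ i, 0 ≤ w i) (hw1 : ∀ i, w i ≤ 1) (hwq : ∑ i, w i ≤ q) :
    ∑ i, s i * w i ≤ ∑ i : Fin N, if (i : ℕ) < q then s i else 0 := by
  have := sum_mul_le_sum_mul_of_antitone s w (fun i => if (i : ℕ) < q then 1 else 0) hs hs0
    (fun r => by
      rcases le_or_gt (min r N) q with hr | hr
      · refine Finset.sum_le_sum fun i _ => ?_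
        have := i.is_lt
        have := hw1 i
        split_ifs <;> first | omega | linarith
      · calc (∑ i : Fin N, if (i : ℕ) < r then w i else 0) ≤ ∑ i, w i :=
              Finset.sum_le_sum fun i _ => by have := hw0 i; split_ifs <;> linarith
          _ ≤ q := hwq
          _ = ∑ i : Fin N, if (i : ℕ) < r then (if (i : ℕ) < q then (1 : ℝ) else 0) else 0 := by
              have : ∀ i : Fin N, (if (i : ℕ) < r then (if (i : ℕ) < q then (1 : ℝ) else 0) else 0)
                  = if (i : ℕ) < q then 1 else 0 := fun i => by split_ifs <;> first | rfl | omega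
              simp only [this, Finset.sum_boole, Fin.card_filter_val_lt]
              rw [min_eq_right (by omega)])
  simpa using this

/-- Two-dimensional Abel summation. -/
lemma sum_sum_mul_le_of_corner_sums {m n : ℕ} (hmn : n ≤ m) (a : Fin m → ℝ) (b : Fin n → ℝ)
    (ha : Antitone a) (ha0 : ∀ i, 0 ≤ a i) (hb : Antitone b) (hb0 : ∀ j, 0 ≤ b j)
    (W : Fin m → Fin n → ℝ) (s : Fin n → ℝ)
    (h : ∀ p q : ℕ, (∑ i : Fin m, ∑ j : Fin n, if (i : ℕ) < p ∧ (j : ℕ) < q then W i j else 0) ≤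
      ∑ k : Fin n, if (k : ℕ) < p ∧ (k : ℕ) < q then s k else 0) :
    ∑ i, ∑ j, a i * b j * W i j ≤ ∑ k, a (Fin.castLE hmn k) * b k * s k := by
  have h1 := sum_mul_le_sum_mul_of_antitone a (fun i => ∑ j, b j * W i j)
    (fun i : Fin m => ∑ k : Fin n, if i = Fin.castLE hmn k then b k * s k else 0) ha ha0
    (fun p => by
      have h2 := sum_mul_le_sum_mul_of_antitone b
        (fun j => ∑ i : Fin m, if (i : ℕ) < p then W i j else 0)
        (fun k => if (k : ℕ) < p then s k else 0) hb hb0 (fun q => by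
          convert h p q using 1
          · rw [Finset.sum_comm]
            refine Finset.sum_congr rfl fun j _ => ?_
            by_cases hj : (j : ℕ) < q <;> simp [hj]
          · refine Finset.sum_congr rfl fun j _ => ?_
            by_cases hj : (j : ℕ) < q <;> simp [hj])
      convert h2 using 1
      · simp only [Finset.mul_sum]
        rw [Finset.sum_comm]
        refine Finset.sum_congr rfl fun i _ => ?_
        by_cases hj : (i : ℕ) < p <;> simp [hj]
      · have : ∀ i : Fin m, (if (i : ℕ) < p then
            ∑ k : Fin n, if i = Fin.castLE hmn k then b k * s k else 0 else 0) =
            ∑ k : Fin n, if i = Fin.castLE hmn k then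
              (if (k : ℕ) < p then b k * s k else 0) else 0 := fun i => by
          split_ifs with hi
          · refine Finset.sum_congr rfl fun k _ => ?_
            split_ifs with h1 h2
            · rfl
            · exact absurd (by simpa [h1] using hi) h2
            · rfl
          · symm
            refine Finset.sum_eq_zero fun k _ => ?_
            split_ifs with h1 h2
            · exact absurd (by simpa [h1] using h2) hi
            · rfl
            · rfl
        simp only [this]
        rw [Finset.sum_comm]
        simp)
  simp only [Finset.mul_sum] at h1
  rw [Finset.sum_comm (f := fun i k => a i * if i = Fin.castLE hmn k then b k * s k else 0)] at h1
  simpa [mul_assoc] using h1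

end WeightedSums

section Spectral

/-- Spectral decomposition of a real symmetric matrix with eigenvalues in decreasing order. -/
lemma exists_antitone_diagonalization {n : ℕ} {M : Matrix (Fin n) (Fin n) ℝ}
    (hM : M.IsHermitian) :
    ∃ (V : Matrix (Fin n) (Fin n) ℝ) (s : Fin n → ℝ), Antitone s ∧ Vᵀ * V = 1 ∧ V * Vᵀ = 1 ∧
      Vᵀ * M * V = diagonal s := by
  set U : Matrix (Fin n) (Fin n) ℝ := (hM.eigenvectorUnitary).1 with hU
  have hU1 : Uᵀ * U = 1 := by
    have := Unitary.coe_star_mul_self hM.eigenvectorUnitary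
    rwa [star_eq_conjTranspose, conjTranspose_eq_transpose_of_trivial] at this
  have hUM : Uᵀ * M * U = diagonal hM.eigenvalues := by
    have h := hM.conjStarAlgAut_star_eigenvectorUnitary
    rw [Unitary.conjStarAlgAut_apply] at h
    simpa [star_eq_conjTranspose, conjTranspose_eq_transpose_of_trivial, Function.comp_def]
      using h
  obtain ⟨σ, hσ⟩ : ∃ σ : Equiv.Perm (Fin n), Antitone (hM.eigenvalues ∘ σ) :=
    ⟨Tuple.sort (fun i => -hM.eigenvalues i), fun i j hij => by
      have := Tuple.monotone_sort (fun i => -hM.eigenvalues i) hij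
      simpa using this⟩
  have key : ∀ X : Matrix (Fin n) (Fin n) ℝ,
      (U.submatrix id σ)ᵀ * X * U.submatrix id σ = (Uᵀ * X * U).submatrix σ σ := fun X => by
    ext i j
    simp [Matrix.mul_apply]
  have h1 : (U.submatrix id σ)ᵀ * U.submatrix id σ = 1 := by
    have := key 1
    rw [Matrix.mul_one, Matrix.mul_one, hU1] at this
    rw [this, submatrix_one _ σ.injective]
  refine ⟨U.submatrix id σ, hM.eigenvalues ∘ σ, hσ, h1, mul_eq_one_comm.1 h1, ?_⟩
  rw [key, hUM, submatrix_diagonal _ _ σ.injective]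

/-- If `Uᵀ U` is a diagonal matrix that fixes `U` under right multiplication, then the rows of `U`
have norm at most one. -/
lemma sum_sq_row_le_one {m n : ℕ} (U : Matrix (Fin m) (Fin n) ℝ) (e : Fin n → ℝ)
    (h : Uᵀ * U = diagonal e) (hU : ∀ i k, e k * U i k = U i k)
    (i : Fin m) : ∑ k, U i k ^ 2 ≤ 1 := by
  have hproj : (U * Uᵀ) * (U * Uᵀ) = U * Uᵀ := by
    have : U * diagonal e = U := by
      ext i k
      rw [mul_diagonal, mul_comm, hU]
    rw [Matrix.mul_assoc, ← Matrix.mul_assoc Uᵀ, h, ← Matrix.mul_assoc, this]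
  have hd : (U * Uᵀ) i i = ∑ k, U i k ^ 2 := by
    simp [Matrix.mul_apply, sq]
  have hsq : ((U * Uᵀ) i i) ^ 2 ≤ (U * Uᵀ) i i := by
    conv_rhs => rw [← hproj, Matrix.mul_apply]
    calc ((U * Uᵀ) i i) ^ 2 ≤ ∑ j, ((U * Uᵀ) i j) ^ 2 :=
          Finset.single_le_sum (f := fun j => ((U * Uᵀ) i j) ^ 2)
            (fun j _ => sq_nonneg _) (Finset.mem_univ i)
      _ = _ := Finset.sum_congr rfl fun j _ => by
          rw [sq]
          congr 1
          simp [Matrix.mul_apply, mul_comm]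
  rw [← hd]
  by_contra! hlt
  nlinarith

/-- The corner sums of `A i j ^ 2` are dominated by those of the diagonal of ordered squared
singular values. -/
lemma corner_sum_sq_le {m n : ℕ} (A : Matrix (Fin m) (Fin n) ℝ)
    (V : Matrix (Fin n) (Fin n) ℝ) (s : Fin n → ℝ) (hs : Antitone s) (hV : Vᵀ * V = 1)
    (hV' : V * Vᵀ = 1) (hA : Vᵀ * (Aᵀ * A) * V = diagonal s) (p q : ℕ) :
    (∑ i : Fin m, ∑ j : Fin n, if (i : ℕ) < p ∧ (j : ℕ) < q then A i j ^ 2 else 0) ≤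
      ∑ k : Fin n, if (k : ℕ) < p ∧ (k : ℕ) < q then s k else 0 := by
  set P := A * V with hP
  have hPP : Pᵀ * P = diagonal s := by
    rw [← hA, hP, transpose_mul]; simp only [Matrix.mul_assoc]
  have hPs : ∀ k, ∑ i, P i k ^ 2 = s k := fun k => by
    have := congrFun (congrFun hPP k) k
    simpa [Matrix.mul_apply, sq] using this
  have hs0 : ∀ k, 0 ≤ s k := fun k => hPs k ▸ Finset.sum_nonneg fun _ _ => sq_nonneg _
  have hcol : ∀ j, ∑ i, A i j ^ 2 = ∑ k, s k * V j k ^ 2 := fun j => by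
    have h1 : Aᵀ * A = V * diagonal s * Vᵀ := by
      rw [← hA]
      calc Aᵀ * A = (V * Vᵀ) * (Aᵀ * A) * (V * Vᵀ) := by rw [hV']; simp
        _ = _ := by simp only [Matrix.mul_assoc]
    have := congrFun (congrFun h1 j) j
    rw [Matrix.mul_apply, Matrix.mul_apply] at this
    simpa [sq, mul_comm, mul_left_comm, mul_assoc] using this
  have hrow : ∀ i, ∑ j, A i j ^ 2 = ∑ k, P i k ^ 2 := fun i => by
    have h1 : A * Aᵀ = P * Pᵀ := by
      rw [hP, transpose_mul, Matrix.mul_assoc, ← Matrix.mul_assoc V, hV', Matrix.one_mul]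
    have := congrFun (congrFun h1 i) i
    simpa [Matrix.mul_apply, sq] using this
  rcases le_total q p with hqp | hpq
  · calc (∑ i : Fin m, ∑ j : Fin n, if (i : ℕ) < p ∧ (j : ℕ) < q then A i j ^ 2 else 0)
        ≤ ∑ i : Fin m, ∑ j : Fin n, if (j : ℕ) < q then A i j ^ 2 else 0 := by
          refine Finset.sum_le_sum fun i _ => Finset.sum_le_sum fun j _ => ?_
          have := sq_nonneg (A i j)
          split_ifs <;> linarith
      _ = ∑ j : Fin n, if (j : ℕ) < q then ∑ k, s k * V j k ^ 2 else 0 := by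
          rw [Finset.sum_comm]
          refine Finset.sum_congr rfl fun j _ => ?_
          split_ifs
          · exact hcol j
          · simp
      _ = ∑ k, s k * ∑ j : Fin n, if (j : ℕ) < q then V j k ^ 2 else 0 := by
          simp only [Finset.mul_sum]
          rw [Finset.sum_comm]
          refine Finset.sum_congr rfl fun j _ => ?_
          split_ifs <;> simp
      _ ≤ ∑ k : Fin n, if (k : ℕ) < q then s k else 0 := by
          refine sum_mul_weight_le s _ hs hs0 q
            (fun k => Finset.sum_nonneg fun j _ => ?_) (fun k => ?_) ?_
          · split_ifs <;> positivity
          · have := congrFun (congrFun hV k) k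
            simp only [Matrix.mul_apply, transpose_apply, one_apply_eq, ← sq] at this
            rw [← this]
            refine Finset.sum_le_sum fun j _ => ?_
            split_ifs
            · exact le_rfl
            · positivity
          · rw [Finset.sum_comm]
            have : ∀ j : Fin n, (∑ k, if (j : ℕ) < q then V j k ^ 2 else 0) =
                if (j : ℕ) < q then 1 else 0 := fun j => by
              have := congrFun (congrFun hV' j) j
              simp only [Matrix.mul_apply, transpose_apply, one_apply_eq, ← sq] at this
              split_ifs <;> simp [this]
            simp only [this, Finset.sum_boole, Fin.card_filter_val_lt]
            exact_mod_cast min_le_right _ _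
      _ = _ := Finset.sum_congr rfl fun k _ => by split_ifs <;> first | rfl | omega
  · set U : Matrix (Fin m) (Fin n) ℝ := of fun i k => P i k / Real.sqrt (s k) with hU
    have hP0 : ∀ i k, s k = 0 → P i k = 0 := fun i k hk => by
      have h := hPs k
      rw [hk, Finset.sum_eq_zero_iff_of_nonneg fun _ _ => sq_nonneg _] at h
      exact pow_eq_zero_iff (two_ne_zero) |>.1 (h i (Finset.mem_univ i))
    have hPU : ∀ i k, P i k ^ 2 = s k * U i k ^ 2 := fun i k => by
      rcases (hs0 k).eq_or_lt with hk | hk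
      · simp [hP0 i k hk.symm, ← hk]
      · simp only [hU, of_apply, div_pow, Real.sq_sqrt (hs0 k)]
        field_simp
    have hUU : Uᵀ * U = diagonal fun k => if s k = 0 then 0 else 1 := by
      ext k l
      have hkl := congrFun (congrFun hPP k) l
      simp only [Matrix.mul_apply, transpose_apply] at hkl ⊢
      have : ∑ i, U i k * U i l = (∑ i, P i k * P i l) / (Real.sqrt (s k) * Real.sqrt (s l)) := by
        rw [Finset.sum_div]
        refine Finset.sum_congr rfl fun i _ => ?_
        simp only [hU, of_apply]
        rw [div_mul_div_comm]
      rw [this, hkl]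
      by_cases h : k = l
      · subst h
        rw [diagonal_apply_eq, diagonal_apply_eq, Real.mul_self_sqrt (hs0 k)]
        split_ifs with h0
        · simp [h0]
        · exact div_self h0
      · simp [diagonal_apply_ne _ h]
    have hUrow := sum_sq_row_le_one U (fun k => if s k = 0 then 0 else 1)
      hUU (fun i k => by
        split_ifs with h0
        · simp [hU, h0]
        · simp)
    calc (∑ i : Fin m, ∑ j : Fin n, if (i : ℕ) < p ∧ (j : ℕ) < q then A i j ^ 2 else 0)
        ≤ ∑ i : Fin m, ∑ j : Fin n, if (i : ℕ) < p then A i j ^ 2 else 0 := by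
          refine Finset.sum_le_sum fun i _ => Finset.sum_le_sum fun j _ => ?_
          have := sq_nonneg (A i j)
          split_ifs <;> linarith
      _ = ∑ i : Fin m, if (i : ℕ) < p then ∑ k, s k * U i k ^ 2 else 0 := by
          refine Finset.sum_congr rfl fun i _ => ?_
          simp only [← hPU, ← hrow]
          split_ifs <;> simp
      _ = ∑ k, s k * ∑ i : Fin m, if (i : ℕ) < p then U i k ^ 2 else 0 := by
          simp only [Finset.mul_sum]
          rw [Finset.sum_comm]
          refine Finset.sum_congr rfl fun j _ => ?_
          split_ifs <;> simp
      _ ≤ ∑ k : Fin n, if (k : ℕ) < p then s k else 0 := by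
          refine sum_mul_weight_le s _ hs hs0 p
            (fun k => Finset.sum_nonneg fun j _ => ?_) (fun k => ?_) ?_
          · split_ifs <;> positivity
          · have := congrFun (congrFun hUU k) k
            simp only [Matrix.mul_apply, transpose_apply, diagonal_apply_eq, ← sq] at this
            calc (∑ i : Fin m, if (i : ℕ) < p then U i k ^ 2 else 0) ≤ ∑ i, U i k ^ 2 := by
                  refine Finset.sum_le_sum fun j _ => ?_
                  split_ifs
                  · exact le_rfl
                  · positivity
              _ ≤ 1 := by rw [this]; split_ifs <;> norm_num
          · rw [Finset.sum_comm]
            calc (∑ i : Fin m, ∑ k, if (i : ℕ) < p then U i k ^ 2 else 0)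
                ≤ ∑ i : Fin m, if (i : ℕ) < p then (1 : ℝ) else 0 := by
                  refine Finset.sum_le_sum fun i _ => ?_
                  split_ifs
                  · exact hUrow i
                  · simp
              _ ≤ p := by
                  simp only [Finset.sum_boole, Fin.card_filter_val_lt]
                  exact_mod_cast min_le_right _ _
      _ = _ := Finset.sum_congr rfl fun k _ => by split_ifs <;> first | rfl | omega

/-- The scalar problem: minimization over a single squared correlation `s ∈ [0, 1)`. -/
lemma scalar_objective_le {p ε s : ℝ} (hp : 0 < p) (hε : 0 < ε) (hs0 : 0 ≤ s) (hs : s < 1) :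
    -2 * max (p - ε / 4) 0 + ε / 2 * max (Real.log p - Real.log (ε / 4)) 0 ≤
      -2 * (p * s) - ε / 2 * Real.log (1 - s) := by
  have hlog : ∀ t : ℝ, 0 < t → Real.log (1 - s) ≤ Real.log t + ((1 - s) / t - 1) := fun t ht => by
    have := Real.log_le_sub_one_of_pos (div_pos (sub_pos.2 hs) ht)
    rw [Real.log_div (sub_pos.2 hs).ne' ht.ne'] at this
    linarith
  rcases le_total p (ε / 4) with h | h
  · rw [max_eq_right (by linarith), max_eq_right (by linarith [Real.log_le_log hp h])]
    have := hlog 1 one_pos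
    simp only [Real.log_one, div_one] at this
    nlinarith
  · rw [max_eq_left (by linarith),
      max_eq_left (by linarith [Real.log_le_log (by positivity) h])]
    have := hlog (ε / 4 / p) (by positivity)
    rw [Real.log_div (by positivity) hp.ne'] at this
    have h2 : (1 - s) / (ε / 4 / p) * (ε / 2) = 2 * (p * (1 - s)) := by field_simp; ring
    nlinarith

/-- The finite-dimensional minimization problem over cross-covariances, in terms of the matrix
of correlations `A`. -/
lemma correlation_objective_le {m n : ℕ} (hmn : n ≤ m) (a : Fin m → ℝ) (b : Fin n → ℝ)
    (ha : Antitone a) (ha0 : ∀ i, 0 < a i) (hb : Antitone b) (hb0 : ∀ j, 0 < b j)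
    {ε : ℝ} (hε : 0 < ε) (A : Matrix (Fin m) (Fin n) ℝ) (hA : (1 - Aᵀ * A).PosDef) :
    - 2 * ∑ k, max (a (Fin.castLE hmn k) * b k - ε / 4) 0 +
      ε / 2 * ∑ k, max (Real.log (a (Fin.castLE hmn k) * b k) - Real.log (ε / 4)) 0 ≤
    - 2 * ∑ i, ∑ j, a i * b j * A i j ^ 2 - ε / 2 * Real.log (1 - Aᵀ * A).det := by
  have hM : (Aᵀ * A).IsHermitian := by
    rw [← conjTranspose_eq_transpose_of_trivial]
    exact isHermitian_conjTranspose_mul_self A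
  obtain ⟨V, s, hs, hV, hV', hVA⟩ := exists_antitone_diagonalization hM
  have h1 : Vᵀ * (1 - Aᵀ * A) * V = diagonal fun k => 1 - s k := by
    rw [Matrix.mul_sub, Matrix.sub_mul, hVA, Matrix.mul_one, hV, ← diagonal_one, diagonal_sub]
  have hs1 : ∀ k, s k < 1 := fun k => by
    have hV0 : Function.Injective V.mulVec := fun x y hxy => by
      have := congrArg (Vᵀ *ᵥ ·) hxy
      simpa [mulVec_mulVec, hV] using this
    have := hA.conjTranspose_mul_mul_same hV0
    rw [conjTranspose_eq_transpose_of_trivial, h1, posDef_diagonal_iff] at this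
    linarith [this k]
  have hs0 : ∀ k, 0 ≤ s k := fun k => by
    have := (posSemidef_conjTranspose_mul_self A).conjTranspose_mul_mul_same V
    rw [conjTranspose_eq_transpose_of_trivial, conjTranspose_eq_transpose_of_trivial, hVA,
      posSemidef_diagonal_iff] at this
    exact this k
  have hdet : (1 - Aᵀ * A).det = ∏ k, (1 - s k) := by
    rw [← det_diagonal, ← h1, det_mul, det_mul, mul_right_comm, ← det_mul, hV, det_one, one_mul]
  have hsum := sum_sum_mul_le_of_corner_sums hmn a b ha (fun i => (ha0 i).le) hb
    (fun j => (hb0 j).le) (fun i j => A i j ^ 2) s (corner_sum_sq_le A V s hs hV hV' hVA)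
  rw [hdet, Real.log_prod fun k _ => (sub_pos.2 (hs1 k)).ne']
  have := Finset.sum_le_sum fun (k : Fin n) (_ : k ∈ Finset.univ) =>
    scalar_objective_le (mul_pos (ha0 (Fin.castLE hmn k)) (hb0 k)) hε (hs0 k) (hs1 k)
  simp only [Finset.sum_add_distrib, Finset.sum_sub_distrib, ← Finset.mul_sum] at this
  linarith

end Spectral

section BlockMatrix

variable {m n : ℕ}

lemma posDef_schur_of_fromBlocks_one (A : Matrix (Fin m) (Fin n) ℝ)
    (h : (fromBlocks 1 A Aᵀ 1).PosDef) : (1 - Aᵀ * A).PosDef := by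
  have hinj : Function.Injective (fromRows (-A) (1 : Matrix (Fin n) (Fin n) ℝ)).mulVec := by
    intro x y hxy
    simpa using congrArg (fun z => z ∘ Sum.inr) hxy
  have := h.conjTranspose_mul_mul_same hinj
  rw [conjTranspose_eq_transpose_of_trivial, transpose_fromRows, fromCols_mul_fromBlocks,
    fromCols_mul_fromRows] at this
  convert this using 1
  simp [sub_eq_add_neg, add_comm]

/-- Lower bound of the objective over all cross-covariance matrices. -/
lemma covariance_objective_le (hmn : n ≤ m) (a : Fin m → ℝ) (b : Fin n → ℝ)
    (ha : Antitone a) (ha0 : ∀ i, 0 < a i) (hb : Antitone b) (hb0 : ∀ j, 0 < b j)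
    {ε : ℝ} (hε : 0 < ε) (K : Matrix (Fin m) (Fin n) ℝ)
    (hK : (fromBlocks (diagonal a) K Kᵀ (diagonal b)).PosDef) :
    - 2 * ∑ k, max (a (Fin.castLE hmn k) * b k - ε / 4) 0 +
      ε / 2 * ∑ k, max (Real.log (a (Fin.castLE hmn k) * b k) - Real.log (ε / 4)) 0 ≤
    - 2 * ∑ i, ∑ j, K i j ^ 2 - ε / 2 *
      Real.log ((fromBlocks (diagonal a) K Kᵀ (diagonal b)).det /
        (fromBlocks (diagonal a) 0 0 (diagonal b)).det) := by
  have hsa : ∀ i, Real.sqrt (a i) ≠ 0 := fun i => (Real.sqrt_pos.2 (ha0 i)).ne'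
  have hsb : ∀ i, Real.sqrt (b i) ≠ 0 := fun i => (Real.sqrt_pos.2 (hb0 i)).ne'
  set A : Matrix (Fin m) (Fin n) ℝ := of fun i j => K i j / (Real.sqrt (a i) * Real.sqrt (b j))
    with hA
  set D : Matrix (Fin m ⊕ Fin n) (Fin m ⊕ Fin n) ℝ :=
    fromBlocks (diagonal fun i => Real.sqrt (a i)) 0 0 (diagonal fun j => Real.sqrt (b j)) with hD
  have hS : fromBlocks (diagonal a) K Kᵀ (diagonal b) = D * fromBlocks 1 A Aᵀ 1 * Dᵀ := by
    rw [hD, fromBlocks_transpose, fromBlocks_multiply, fromBlocks_multiply]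
    simp only [diagonal_transpose, Matrix.mul_one, Matrix.zero_mul, add_zero, zero_add,
      diagonal_mul_diagonal, transpose_zero, Matrix.mul_zero, Real.mul_self_sqrt (ha0 _).le,
      Real.mul_self_sqrt (hb0 _).le]
    congr 1 <;> ext i j
    · have := hsa i; have := hsb j
      simp only [hA, mul_diagonal, diagonal_mul, of_apply]
      field_simp
    · have := hsa j; have := hsb i
      simp only [hA, mul_diagonal, diagonal_mul, transpose_apply, of_apply]
      field_simp
  have hS0 : fromBlocks (diagonal a) 0 0 (diagonal b) = D * Dᵀ := by
    rw [hD, fromBlocks_transpose, fromBlocks_multiply]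
    simp [Real.mul_self_sqrt (ha0 _).le, Real.mul_self_sqrt (hb0 _).le]
  have hdetD : D.det ≠ 0 := by
    rw [hD, det_fromBlocks_zero₂₁, det_diagonal, det_diagonal]
    exact mul_ne_zero (Finset.prod_ne_zero_iff.2 fun i _ => hsa i)
      (Finset.prod_ne_zero_iff.2 fun i _ => hsb i)
  have hN : (fromBlocks 1 A Aᵀ 1).PosDef := by
    have hu : IsUnit D := (isUnit_iff_isUnit_det D).2 hdetD.isUnit
    rw [← hu.posDef_star_right_conjugate_iff, star_eq_conjTranspose,
      conjTranspose_eq_transpose_of_trivial, ← hS]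
    exact hK
  have hdet : (fromBlocks (diagonal a) K Kᵀ (diagonal b)).det /
      (fromBlocks (diagonal a) 0 0 (diagonal b)).det = (1 - Aᵀ * A).det := by
    rw [hS, hS0, det_mul, det_mul, det_mul, det_fromBlocks_one₁₁, det_transpose]
    field_simp
  have hsum : ∑ i, ∑ j, K i j ^ 2 = ∑ i, ∑ j, a i * b j * A i j ^ 2 := by
    refine Finset.sum_congr rfl fun i _ => Finset.sum_congr rfl fun j _ => ?_
    have := (ha0 i).ne'; have := (hb0 j).ne'
    simp only [hA, of_apply, div_pow, mul_pow, Real.sq_sqrt (ha0 _).le, Real.sq_sqrt (hb0 _).le]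
    field_simp
  rw [hdet, hsum]
  exact correlation_objective_le hmn a b ha ha0 hb hb0 hε A
    (posDef_schur_of_fromBlocks_one A hN)

end BlockMatrix

section Gaussian

open ProbabilityTheory

lemma map_withDensity_comp {α β : Type*} [MeasurableSpace α] [MeasurableSpace β] (μ : Measure α)
    {T : α → β} (hT : Measurable T) {h : β → ℝ≥0∞} (hh : Measurable h) :
    (μ.withDensity (h ∘ T)).map T = (μ.map T).withDensity h := by
  ext s hs
  rw [Measure.map_apply hT hs, withDensity_apply _ (hT hs), withDensity_apply _ hs,
    setLIntegral_map hs hh hT]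
  rfl

/-- Splitting the coordinates indexed by a sum type, as a continuous linear map. -/
def sumPiToProd (ι κ : Type*) : (ι ⊕ κ → ℝ) →L[ℝ] (ι → ℝ) × (κ → ℝ) :=
  (ContinuousLinearMap.pi fun i => ContinuousLinearMap.proj (Sum.inl i)).prod
    (ContinuousLinearMap.pi fun i => ContinuousLinearMap.proj (Sum.inr i))

lemma sumPiToProd_single_inl {ι κ : Type*} [DecidableEq κ] [DecidableEq ι] (i : ι) :
    sumPiToProd ι κ (Pi.single (Sum.inl i) 1) = (Pi.single i 1, 0) := by
  ext j <;> simp [sumPiToProd, Pi.single_apply]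

lemma sumPiToProd_single_inr {ι κ : Type*} [DecidableEq ι] [DecidableEq κ] (i : κ) :
    sumPiToProd ι κ (Pi.single (Sum.inr i) 1) = (0, Pi.single i 1) := by
  ext j <;> simp [sumPiToProd, Pi.single_apply]

@[fun_prop]
lemma measurable_mulVec {ι κ : Type*} [Fintype ι] (L : Matrix κ ι ℝ) :
    Measurable fun x : ι → ℝ => L *ᵥ x :=
  measurable_pi_iff.2 fun i => by simp only [mulVec, dotProduct]; fun_prop

variable {ι : Type*} [Fintype ι] [DecidableEq ι]

@[fun_prop]
lemma measurable_gaussianPdf (S : Matrix ι ι ℝ) : Measurable (gaussianPdf S) := by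
  unfold gaussianPdf
  simp only [dotProduct, mulVec]
  fun_prop

lemma gaussianMeasure_map_mulVec (L S : Matrix ι ι ℝ) (hL : L.det ≠ 0) :
    (gaussianMeasure S).map (L *ᵥ ·) = gaussianMeasure (L * S * Lᵀ) := by
  have hLu : IsUnit L.det := hL.isUnit
  have hg : gaussianPdf S = (gaussianPdf S ∘ (L⁻¹ *ᵥ ·)) ∘ (L *ᵥ ·) := by
    ext x
    simp [mulVec_mulVec, nonsing_inv_mul _ hLu]
  have hvol : (volume : Measure (ι → ℝ)).map (L *ᵥ ·)
      = ENNReal.ofReal |(L.det)⁻¹| • volume := by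
    rw [← Real.map_matrix_volume_pi_eq_smul_volume_pi hL]
    rfl
  rw [gaussianMeasure, hg, map_withDensity_comp _ (by fun_prop) (by fun_prop), hvol,
    withDensity_smul_measure, ← withDensity_smul _ (by fun_prop), gaussianMeasure]
  congr 1
  ext x
  simp only [Pi.smul_apply, Function.comp_apply, smul_eq_mul, gaussianPdf]
  rw [← ENNReal.ofReal_mul (abs_nonneg _)]
  congr 1
  have hdet : Real.sqrt ((2 * Real.pi) ^ Fintype.card ι * (L * S * Lᵀ).det) =
      |L.det| * Real.sqrt ((2 * Real.pi) ^ Fintype.card ι * S.det) := by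
    rw [det_mul, det_mul, det_transpose, ← Real.sqrt_sq_eq_abs, ← Real.sqrt_mul (sq_nonneg _)]
    ring_nf
  have hq : (L⁻¹ *ᵥ x) ⬝ᵥ (S⁻¹ *ᵥ (L⁻¹ *ᵥ x)) = x ⬝ᵥ ((L * S * Lᵀ)⁻¹ *ᵥ x) := by
    rw [Matrix.mul_inv_rev, Matrix.mul_inv_rev, ← transpose_nonsing_inv, ← mulVec_mulVec,
      ← mulVec_mulVec, dotProduct_mulVec x, vecMul_transpose]
  rw [hdet, hq, abs_inv]
  field_simp

lemma gaussianPdf_one (x : ι → ℝ) :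
    gaussianPdf 1 x = ENNReal.ofReal (∏ i, gaussianPDFReal 0 1 (x i)) := by
  rw [gaussianPdf]
  congr 1
  simp only [gaussianPDFReal]
  rw [Finset.prod_mul_distrib, ← Real.exp_sum, Finset.prod_const, div_eq_inv_mul]
  congr 1
  · simp [Real.sqrt_eq_rpow, ← Real.rpow_natCast, ← Real.rpow_mul, Real.pi_pos.le, mul_comm]
  · simp [dotProduct, sq, Finset.sum_div, Finset.sum_neg_distrib, neg_div]

lemma gaussianMeasure_one :
    gaussianMeasure (1 : Matrix ι ι ℝ) = Measure.pi fun _ => gaussianReal 0 1 := by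
  symm
  refine Measure.pi_eq fun s hs => ?_
  rw [gaussianMeasure, withDensity_apply _ (MeasurableSet.univ_pi hs), volume_pi,
    Measure.restrict_pi_pi]
  simp only [gaussianReal_apply_eq_integral _ one_ne_zero, gaussianPdf_one]
  rw [← ofReal_integral_eq_lintegral_ofReal, integral_fintype_prod_eq_prod,
    ENNReal.ofReal_prod_of_nonneg]
  · exact fun i _ => integral_nonneg fun x => gaussianPDFReal_nonneg _ _ _
  · exact Integrable.fintype_prod fun i => (integrable_gaussianPDFReal 0 1).integrableOn
  · exact Filter.Eventually.of_forall fun x =>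
      Finset.prod_nonneg fun i _ => gaussianPDFReal_nonneg _ _ _

open scoped MatrixOrder in
lemma gaussianMeasure_eq_map_multivariateGaussian {S : Matrix ι ι ℝ} (hS : S.PosDef) :
    gaussianMeasure S = (multivariateGaussian 0 S).map (WithLp.ofLp) := by
  have hsq : CFC.sqrt S * CFC.sqrt S = S := CFC.sqrt_mul_sqrt_self _ hS.posSemidef.nonneg
  have hT : (CFC.sqrt S)ᵀ = CFC.sqrt S := by
    have := (CFC.sqrt_nonneg S).isSelfAdjoint
    rwa [IsSelfAdjoint, star_eq_conjTranspose, conjTranspose_eq_transpose_of_trivial] at this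
  have hdet : (CFC.sqrt S).det ≠ 0 := fun h => hS.det_pos.ne' (by rw [← hsq, det_mul, h, zero_mul])
  rw [multivariateGaussian, ← map_pi_eq_stdGaussian, ← gaussianMeasure_one,
    Measure.map_map (by fun_prop) (by fun_prop), Measure.map_map (by fun_prop) (by fun_prop)]
  trans (gaussianMeasure 1).map (CFC.sqrt S *ᵥ ·)
  · rw [gaussianMeasure_map_mulVec _ _ hdet, hT, Matrix.mul_one, hsq]
  congr 1
  ext x i
  simp

lemma isProbabilityMeasure_gaussianMeasure {S : Matrix ι ι ℝ} (hS : S.PosDef) :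
    IsProbabilityMeasure (gaussianMeasure S) := by
  rw [gaussianMeasure_eq_map_multivariateGaussian hS]
  exact Measure.isProbabilityMeasure_map (by fun_prop)

lemma memLp_two_eval_multivariateGaussian (S : Matrix ι ι ℝ) (i : ι) :
    MemLp (fun x : EuclideanSpace ℝ ι => x i) 2 (multivariateGaussian 0 S) :=
  (EuclideanSpace.proj (𝕜 := ℝ) i : EuclideanSpace ℝ ι →L[ℝ] ℝ).comp_memLp'
    IsGaussian.memLp_two_id

lemma memLp_two_eval_gaussianMeasure {S : Matrix ι ι ℝ} (hS : S.PosDef) (i : ι) :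
    MemLp (fun x : ι → ℝ => x i) 2 (gaussianMeasure S) := by
  rw [gaussianMeasure_eq_map_multivariateGaussian hS]
  refine (memLp_map_measure_iff (measurable_pi_apply i).aestronglyMeasurable (by fun_prop)).2 ?_
  exact memLp_two_eval_multivariateGaussian S i

lemma integral_eval_mul_eval_gaussianMeasure {S : Matrix ι ι ℝ} (hS : S.PosDef) (i j : ι) :
    ∫ x, x i * x j ∂gaussianMeasure S = S i j := by
  rw [gaussianMeasure_eq_map_multivariateGaussian hS, integral_map (by fun_prop)
    (by fun_prop)]
  have h := covariance_eval_multivariateGaussian (μ := 0) hS.posSemidef i j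
  have hz : ∀ k, ∫ x, x k ∂(multivariateGaussian 0 S) = 0 := fun k => by
    have := (EuclideanSpace.proj (𝕜 := ℝ) k).integral_comp_comm
      (IsGaussian.integrable_id (μ := multivariateGaussian 0 S))
    simpa using this
  rw [covariance_eq_sub] at h
  · simpa [hz] using h
  all_goals exact memLp_two_eval_multivariateGaussian S _

lemma charFunDual_gaussianMeasure {S : Matrix ι ι ℝ} (hS : S.PosDef) (L : StrongDual ℝ (ι → ℝ)) :
    charFunDual (gaussianMeasure S) L =
      Complex.exp (-((fun i => L (Pi.single i 1)) ⬝ᵥ S *ᵥ fun i => L (Pi.single i 1) : ℝ) / 2) := by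
  rw [gaussianMeasure_eq_map_multivariateGaussian hS]
  have hL : L.comp (EuclideanSpace.equiv ι ℝ : EuclideanSpace ℝ ι →L[ℝ] ι → ℝ) =
      InnerProductSpace.toDualMap ℝ _ (WithLp.toLp 2 fun i => L (Pi.single i 1)) := by
    ext x
    have hx : x.ofLp = ∑ i, x i • Pi.single i (1 : ℝ) := by
      ext j; simp [Finset.sum_apply, Pi.single_apply]
    change L x.ofLp = _
    rw [hx, map_sum]
    simp [PiLp.inner_apply]
  have := charFunDual_map (μ := multivariateGaussian 0 S)
    (EuclideanSpace.equiv ι ℝ : EuclideanSpace ℝ ι →L[ℝ] ι → ℝ) L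
  rw [hL, ← charFun_eq_charFunDual_toDualMap, charFun_multivariateGaussian hS.posSemidef] at this
  change charFunDual (Measure.map WithLp.ofLp (multivariateGaussian 0 S)) L = _ at this
  simpa [neg_div] using this

variable {κ : Type*} [Fintype κ] [DecidableEq κ]

lemma gaussianMeasure_fromBlocks_zero_map {A : Matrix ι ι ℝ} {D : Matrix κ κ ℝ}
    (hA : A.PosDef) (hD : D.PosDef) (h : (fromBlocks A 0 0 D).PosDef) :
    (gaussianMeasure (fromBlocks A 0 0 D)).map (sumPiToProd ι κ) =
      (gaussianMeasure A).prod (gaussianMeasure D) := by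
  have := isProbabilityMeasure_gaussianMeasure hA
  have := isProbabilityMeasure_gaussianMeasure hD
  have := isProbabilityMeasure_gaussianMeasure h
  refine Measure.ext_of_charFunDual (funext fun L => ?_)
  rw [charFunDual_map, charFunDual_prod, charFunDual_gaussianMeasure h,
    charFunDual_gaussianMeasure hA, charFunDual_gaussianMeasure hD, ← Complex.exp_add]
  congr 1
  simp [dotProduct, mulVec, sumPiToProd_single_inl, sumPiToProd_single_inr]
  ring

lemma gaussianMeasure_fromBlocks_map_fst {A : Matrix ι ι ℝ} {B : Matrix ι κ ℝ} {C : Matrix κ ι ℝ}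
    {D : Matrix κ κ ℝ} (hA : A.PosDef) (h : (fromBlocks A B C D).PosDef) :
    ((gaussianMeasure (fromBlocks A B C D)).map (sumPiToProd ι κ)).map Prod.fst =
      gaussianMeasure A := by
  have := isProbabilityMeasure_gaussianMeasure hA
  have := isProbabilityMeasure_gaussianMeasure h
  refine Measure.ext_of_charFunDual (funext fun L => ?_)
  rw [show (Prod.fst : (ι → ℝ) × (κ → ℝ) → ι → ℝ) = ContinuousLinearMap.fst ℝ _ _ from rfl,
    charFunDual_map, charFunDual_map, charFunDual_gaussianMeasure h,
    charFunDual_gaussianMeasure hA]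
  congr 1
  simp [dotProduct, mulVec, sumPiToProd_single_inl, sumPiToProd_single_inr]

lemma gaussianMeasure_fromBlocks_map_snd {A : Matrix ι ι ℝ} {B : Matrix ι κ ℝ} {C : Matrix κ ι ℝ}
    {D : Matrix κ κ ℝ} (hD : D.PosDef) (h : (fromBlocks A B C D).PosDef) :
    ((gaussianMeasure (fromBlocks A B C D)).map (sumPiToProd ι κ)).map Prod.snd =
      gaussianMeasure D := by
  have := isProbabilityMeasure_gaussianMeasure hD
  have := isProbabilityMeasure_gaussianMeasure h
  refine Measure.ext_of_charFunDual (funext fun L => ?_)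
  rw [show (Prod.snd : (ι → ℝ) × (κ → ℝ) → κ → ℝ) = ContinuousLinearMap.snd ℝ _ _ from rfl,
    charFunDual_map, charFunDual_map, charFunDual_gaussianMeasure h,
    charFunDual_gaussianMeasure hD]
  congr 1
  simp [dotProduct, mulVec, sumPiToProd_single_inl, sumPiToProd_single_inr]

end Gaussian

section RelativeEntropy

variable {X : Type*} [MeasurableSpace X] {α β γ : Measure X} {f : X → ℝ} [IsProbabilityMeasure β]

lemma llr_withDensity_exp (hf : Measurable f)
    (hα : α = β.withDensity fun x => ENNReal.ofReal (Real.exp (f x))) : llr α β =ᵐ[α] f := by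
  have hac : α ≪ β := hα ▸ withDensity_absolutelyContinuous _ _
  refine hac.ae_le ?_
  rw [hα]
  filter_upwards [Measure.rnDeriv_withDensity β
    (show Measurable fun x => ENNReal.ofReal (Real.exp (f x)) by fun_prop)] with x hx
  rw [llr, hx, ENNReal.toReal_ofReal (Real.exp_pos _).le, Real.log_exp]

variable [IsProbabilityMeasure α]

lemma KLgen_eq_integral_llr : KLgen α β = ∫ x, llr α β x ∂α := by
  simp [KLgen, llr]

lemma KLgen_withDensity_exp (hf : Measurable f)
    (hα : α = β.withDensity fun x => ENNReal.ofReal (Real.exp (f x))) :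
    KLgen α β = ∫ x, f x ∂α := by
  rw [KLgen_eq_integral_llr, integral_congr_ae (llr_withDensity_exp hf hα)]

/-- Gibbs variational bound for the relative entropy. -/
lemma integral_le_KLgen [IsProbabilityMeasure γ] (hf : Measurable f)
    (hα : α = β.withDensity fun x => ENNReal.ofReal (Real.exp (f x)))
    (hγ : γ ≪ β) (hllr : Integrable (llr γ β) γ) (hfγ : Integrable f γ) :
    ∫ x, f x ∂γ ≤ KLgen γ β := by
  have hlint : ∫⁻ x, ENNReal.ofReal (Real.exp (f x)) ∂β = 1 := by
    rw [← setLIntegral_univ, ← withDensity_apply _ MeasurableSet.univ, ← hα, measure_univ]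
  have hexp : Integrable (fun x => Real.exp (f x)) β := by
    refine ⟨by fun_prop, ?_⟩
    rw [hasFiniteIntegral_iff_ofReal (Filter.Eventually.of_forall fun x => (Real.exp_pos _).le),
      hlint]
    exact ENNReal.one_lt_top
  have hint : ∫ x, Real.exp (f x) ∂β = 1 := by
    rw [integral_eq_lintegral_of_nonneg_ae
      (Filter.Eventually.of_forall fun x => (Real.exp_pos _).le) (by fun_prop), hlint,
      ENNReal.toReal_one]
  have htilt : β.tilted f = α := by
    rw [hα, Measure.tilted]
    simp only [hint, div_one]
  have hac : γ ≪ α := htilt ▸ hγ.trans (absolutelyContinuous_tilted hexp)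
  have hllr' : Integrable (llr γ α) γ := by
    rw [← htilt]
    exact integrable_llr_tilted_right hγ hfγ hllr hexp
  have h := InformationTheory.integral_llr_add_sub_measure_univ_nonneg hac hllr'
  have h' := integral_llr_tilted_right hγ hfγ hexp hllr
  rw [htilt, hint, Real.log_one] at h'
  rw [KLgen_eq_integral_llr]
  simp only [probReal_univ] at h
  linarith

end RelativeEntropy

section SecondMoment

variable {ι X : Type*} [MeasurableSpace X] {γ : Measure X} {Z : X → ι → ℝ}

lemma integrable_coord_mul_coord (hZ : ∀ i, MemLp (fun x => Z x i) 2 γ) (c : ℝ) (i j : ι) :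
    Integrable (fun x => Z x i * (c * Z x j)) γ := by
  convert ((hZ i).integrable_mul (hZ j)).const_mul c using 2
  simp only [Pi.mul_apply]
  ring

variable [Fintype ι]

lemma integrable_quadForm (hZ : ∀ i, MemLp (fun x => Z x i) 2 γ) (M : Matrix ι ι ℝ) :
    Integrable (fun x => Z x ⬝ᵥ (M *ᵥ Z x)) γ := by
  simp only [dotProduct, mulVec, Finset.mul_sum]
  exact integrable_finsetSum _ fun i _ => integrable_finsetSum _ fun j _ =>
    integrable_coord_mul_coord hZ _ i j

lemma integral_quadForm (hZ : ∀ i, MemLp (fun x => Z x i) 2 γ) (M C : Matrix ι ι ℝ)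
    (hC : ∀ i j, ∫ x, Z x i * Z x j ∂γ = C i j) :
    ∫ x, Z x ⬝ᵥ (M *ᵥ Z x) ∂γ = trace (M * Cᵀ) := by
  have hij := fun i j => integrable_coord_mul_coord hZ (M i j) i j
  simp only [dotProduct, mulVec, Finset.mul_sum, trace, diag, mul_apply, transpose_apply]
  rw [integral_finsetSum _ fun i _ => integrable_finsetSum _ fun j _ => hij i j]
  refine Finset.sum_congr rfl fun i _ => ?_
  rw [integral_finsetSum _ fun j _ => hij i j]
  refine Finset.sum_congr rfl fun j _ => ?_
  rw [← hC, ← integral_const_mul]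
  exact integral_congr_ae (Filter.Eventually.of_forall fun x => by ring)

lemma sq_weighted_sum_eq (s : ι → ℝ) (u v : ι → ℝ) : (∑ i, s i * (u i * v i)) ^ 2 =
    ∑ i, ∑ j, s i * s j * ((u i * u j) * (v i * v j)) := by
  rw [sq, Finset.sum_mul_sum]
  exact Finset.sum_congr rfl fun i _ => Finset.sum_congr rfl fun j _ => by ring

lemma integrable_sq_weighted_inner [SFinite γ] (hZ : ∀ i, MemLp (fun x => Z x i) 2 γ)
    (s : ι → ℝ) :
    Integrable (fun p : X × X => (∑ i, s i * (Z p.1 i * Z p.2 i)) ^ 2) (γ.prod γ) := by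
  simp only [sq_weighted_sum_eq]
  refine integrable_finsetSum _ fun i _ => integrable_finsetSum _ fun j _ => ?_
  exact (((hZ i).integrable_mul (hZ j)).mul_prod ((hZ i).integrable_mul (hZ j))).const_mul _

lemma integral_sq_weighted_inner [SFinite γ] (hZ : ∀ i, MemLp (fun x => Z x i) 2 γ)
    (s : ι → ℝ) (C : Matrix ι ι ℝ) (hC : ∀ i j, ∫ x, Z x i * Z x j ∂γ = C i j) :
    ∫ x, ∫ y, (∑ i, s i * (Z x i * Z y i)) ^ 2 ∂γ ∂γ =
      ∑ i, ∑ j, s i * s j * C i j ^ 2 := by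
  have hij : ∀ i j, Integrable (fun p : X × X =>
      s i * s j * ((Z p.1 i * Z p.1 j) * (Z p.2 i * Z p.2 j))) (γ.prod γ) := fun i j =>
    (((hZ i).integrable_mul (hZ j)).mul_prod ((hZ i).integrable_mul (hZ j))).const_mul _
  rw [integral_integral (f := fun x y => (∑ i, s i * (Z x i * Z y i)) ^ 2)
    (integrable_sq_weighted_inner hZ s)]
  simp only [sq_weighted_sum_eq]
  rw [integral_finsetSum _ fun i _ => integrable_finsetSum _ fun j _ => hij i j]
  refine Finset.sum_congr rfl fun i _ => ?_
  rw [integral_finsetSum _ fun j _ => hij i j]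
  refine Finset.sum_congr rfl fun j _ => ?_
  rw [integral_const_mul, integral_prod_mul (fun x => Z x i * Z x j) fun x => Z x i * Z x j,
    hC, sq]

/-- A second moment matrix is positive definite as soon as no hyperplane has full measure. -/
lemma posDef_of_second_moment (hZ : ∀ i, MemLp (fun x => Z x i) 2 γ) (C : Matrix ι ι ℝ)
    (hC : ∀ i j, ∫ x, Z x i * Z x j ∂γ = C i j)
    (hyp : ∀ w : ι → ℝ, w ≠ 0 → ¬ ∀ᵐ x ∂γ, w ⬝ᵥ Z x = 0) : C.PosDef := by
  have hsymm : ∀ i j, C j i = C i j := fun i j => by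
    rw [← hC, ← hC]
    exact integral_congr_ae (Filter.Eventually.of_forall fun x => mul_comm _ _)
  have hCT : Cᵀ = C := by ext i j; exact hsymm i j
  refine PosDef.of_dotProduct_mulVec_pos ?_ fun w hw => ?_
  · rw [IsHermitian, conjTranspose_eq_transpose_of_trivial, hCT]
  have hsq : ∀ x, Z x ⬝ᵥ (vecMulVec w w *ᵥ Z x) = (w ⬝ᵥ Z x) ^ 2 := fun x => by
    rw [vecMulVec_mulVec, dotProduct_smul, dotProduct_comm]
    simp [sq, dotProduct_comm]
  have hval : star w ⬝ᵥ (C *ᵥ w) = ∫ x, (w ⬝ᵥ Z x) ^ 2 ∂γ := by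
    simp only [← hsq]
    rw [integral_quadForm hZ _ C hC, hCT, star_trivial, trace_mul_comm, mul_vecMulVec,
      trace_vecMulVec, dotProduct_comm]
  have hint : Integrable (fun x => (w ⬝ᵥ Z x) ^ 2) γ := by
    simp only [← hsq]
    exact integrable_quadForm hZ _
  rw [hval]
  refine lt_of_le_of_ne (integral_nonneg fun x => sq_nonneg _) fun h => hyp w hw ?_
  filter_upwards [(integral_eq_zero_iff_of_nonneg (fun x => sq_nonneg _) hint).1 h.symm] with x hx
  simpa using hx

end SecondMoment

section GaussianCoupling

open ProbabilityTheory

section LogRatio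

variable {ι : Type*} [Fintype ι] [DecidableEq ι]

/-- The logarithm of the density of `N(0, S)` with respect to `N(0, T)`. -/
noncomputable def gaussianLogRatio (S T : Matrix ι ι ℝ) (z : ι → ℝ) : ℝ :=
  z ⬝ᵥ (T⁻¹ *ᵥ z) / 2 - z ⬝ᵥ (S⁻¹ *ᵥ z) / 2 - Real.log (S.det / T.det) / 2

@[fun_prop]
lemma measurable_gaussianLogRatio (S T : Matrix ι ι ℝ) : Measurable (gaussianLogRatio S T) := by
  unfold gaussianLogRatio
  simp only [dotProduct, mulVec]
  fun_prop

lemma gaussianMeasure_eq_withDensity {S T : Matrix ι ι ℝ} (hS : S.PosDef) (hT : T.PosDef) :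
    gaussianMeasure S = (gaussianMeasure T).withDensity fun z =>
      ENNReal.ofReal (Real.exp (gaussianLogRatio S T z)) := by
  rw [gaussianMeasure, gaussianMeasure, ← withDensity_mul _ (by fun_prop) (by fun_prop)]
  congr 1
  ext z
  have h2 : (0 : ℝ) < (2 * Real.pi) ^ Fintype.card ι := by positivity
  have hS' := hS.det_pos
  have hT' := hT.det_pos
  simp only [Pi.mul_apply, gaussianPdf, gaussianLogRatio]
  rw [← ENNReal.ofReal_mul (by positivity)]
  congr 1
  have hlog : Real.exp (Real.log (S.det / T.det) / 2) = Real.sqrt S.det / Real.sqrt T.det := by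
    rw [← Real.sqrt_div hS'.le, Real.sqrt_eq_rpow, Real.rpow_def_of_pos (by positivity)]
    ring_nf
  rw [Real.exp_sub, Real.exp_sub, hlog, neg_div, neg_div, Real.exp_neg, Real.exp_neg,
    Real.sqrt_mul h2.le, Real.sqrt_mul h2.le]
  have := Real.sqrt_pos.2 hS'
  have := Real.sqrt_pos.2 hT'
  have := Real.sqrt_pos.2 h2
  field_simp

variable {X : Type*} [MeasurableSpace X] {γ : Measure X} [IsProbabilityMeasure γ] {Z : X → ι → ℝ}

lemma integrable_gaussianLogRatio (hZ : ∀ i, MemLp (fun x => Z x i) 2 γ) (S T : Matrix ι ι ℝ) :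
    Integrable (fun x => gaussianLogRatio S T (Z x)) γ :=
  (((integrable_quadForm hZ _).div_const 2).sub ((integrable_quadForm hZ _).div_const 2)).sub
    (integrable_const _)

lemma integral_gaussianLogRatio (hZ : ∀ i, MemLp (fun x => Z x i) 2 γ) (S T : Matrix ι ι ℝ)
    (hS : S.PosDef) (hC : ∀ i j, ∫ x, Z x i * Z x j ∂γ = S i j)
    (htr : trace (T⁻¹ * S) = Fintype.card ι) :
    ∫ x, gaussianLogRatio S T (Z x) ∂γ = - Real.log (S.det / T.det) / 2 := by
  have hST : Sᵀ = S := by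
    have := hS.isHermitian
    rwa [IsHermitian, conjTranspose_eq_transpose_of_trivial] at this
  unfold gaussianLogRatio
  rw [integral_sub (f := fun x => Z x ⬝ᵥ (T⁻¹ *ᵥ Z x) / 2 - Z x ⬝ᵥ (S⁻¹ *ᵥ Z x) / 2)
      (((integrable_quadForm hZ _).div_const 2).sub ((integrable_quadForm hZ _).div_const 2))
      (integrable_const _),
    integral_sub ((integrable_quadForm hZ _).div_const 2) ((integrable_quadForm hZ _).div_const 2),
    integral_div, integral_div, integral_quadForm hZ _ S hC, integral_quadForm hZ _ S hC, hST,
    htr, nonsing_inv_mul _ hS.det_pos.ne'.isUnit, trace_one, integral_const]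
  simp
  ring

end LogRatio

variable {ι κ : Type*} [Fintype ι] [Fintype κ] [DecidableEq ι] [DecidableEq κ]
  {A : Matrix ι ι ℝ} {D : Matrix κ κ ℝ}

lemma posDef_fromBlocks_zero (hA : A.PosDef) (hD : D.PosDef) : (fromBlocks A 0 0 D).PosDef := by
  let := hA.isUnit.invertible
  have h := (hA.fromBlocks₁₁ 0 D).2 (by simpa using hD.posSemidef)
  rw [conjTranspose_zero] at h
  rw [h.posDef_iff_det_ne_zero, det_fromBlocks_zero₂₁]
  exact mul_ne_zero hA.det_pos.ne' hD.det_pos.ne'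

lemma trace_inv_fromBlocks_zero_mul (hA : A.PosDef) (hD : D.PosDef) (K : Matrix ι κ ℝ) :
    trace ((fromBlocks A 0 0 D)⁻¹ * fromBlocks A K Kᵀ D) = Fintype.card (ι ⊕ κ) := by
  have hinv : (fromBlocks A 0 0 D)⁻¹ = fromBlocks A⁻¹ 0 0 D⁻¹ := by
    refine inv_eq_right_inv ?_
    simp [fromBlocks_multiply, mul_nonsing_inv _ hA.det_pos.ne'.isUnit,
      mul_nonsing_inv _ hD.det_pos.ne'.isUnit]
  simp [hinv, fromBlocks_multiply, trace, Fintype.sum_sum_type,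
    nonsing_inv_mul _ hA.det_pos.ne'.isUnit,
      nonsing_inv_mul _ hD.det_pos.ne'.isUnit]

lemma measurable_sumElim (ι κ : Type*) :
    Measurable fun p : (ι → ℝ) × (κ → ℝ) => Sum.elim p.1 p.2 :=
  measurable_pi_iff.2 (by rintro (i | i) <;> simp <;> fun_prop)

lemma gaussianMeasure_map_eq_prod_withDensity (hA : A.PosDef) (hD : D.PosDef)
    {S : Matrix (ι ⊕ κ) (ι ⊕ κ) ℝ} (hS : S.PosDef) :
    (gaussianMeasure S).map (sumPiToProd ι κ) =
      ((gaussianMeasure A).prod (gaussianMeasure D)).withDensity fun p =>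
        ENNReal.ofReal (Real.exp
          (gaussianLogRatio S (fromBlocks A 0 0 D) (Sum.elim p.1 p.2))) := by
  have hT := posDef_fromBlocks_zero hA hD
  have helim := measurable_sumElim ι κ
  have hz : ∀ z : ι ⊕ κ → ℝ,
      Sum.elim (sumPiToProd ι κ z).1 (sumPiToProd ι κ z).2 = z := fun z => by
    ext (i | i) <;> rfl
  rw [← gaussianMeasure_fromBlocks_zero_map hA hD hT, ← map_withDensity_comp _
    (sumPiToProd ι κ).continuous.measurable (by fun_prop), gaussianMeasure_eq_withDensity hS hT]
  simp only [Function.comp_def, hz]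

variable {γ : Measure ((ι → ℝ) × (κ → ℝ))}

lemma memLp_two_of_marginals (hA : A.PosDef) (hD : D.PosDef)
    (h1 : γ.map Prod.fst = gaussianMeasure A)
    (h2 : γ.map Prod.snd = gaussianMeasure D) (i : ι ⊕ κ) :
    MemLp (fun p : (ι → ℝ) × (κ → ℝ) => Sum.elim p.1 p.2 i) 2 γ := by
  cases i with
  | inl i =>
    have := memLp_two_eval_gaussianMeasure hA i
    rw [← h1] at this
    exact (memLp_map_measure_iff (measurable_pi_apply i).aestronglyMeasurable (by fun_prop)).1 this
  | inr i =>
    have := memLp_two_eval_gaussianMeasure hD i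
    rw [← h2] at this
    exact (memLp_map_measure_iff (measurable_pi_apply i).aestronglyMeasurable (by fun_prop)).1 this

/-- The cross-covariance matrix of a centered coupling. -/
noncomputable def crossCovariance (γ : Measure ((ι → ℝ) × (κ → ℝ))) : Matrix ι κ ℝ :=
  of fun i j => ∫ p, p.1 i * p.2 j ∂γ

lemma integral_coord_mul_coord (hA : A.PosDef) (hD : D.PosDef)
    (h1 : γ.map Prod.fst = gaussianMeasure A) (h2 : γ.map Prod.snd = gaussianMeasure D)
    (i j : ι ⊕ κ) :
    ∫ p, Sum.elim p.1 p.2 i * Sum.elim p.1 p.2 j ∂γ =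
      fromBlocks A (crossCovariance γ) (crossCovariance γ)ᵀ D i j := by
  rcases i with i | i <;> rcases j with j | j <;>
    simp only [Sum.elim_inl, Sum.elim_inr, fromBlocks_apply₁₁, fromBlocks_apply₁₂,
      fromBlocks_apply₂₁, fromBlocks_apply₂₂, crossCovariance, transpose_apply, of_apply, mul_comm]
  · rw [← integral_eval_mul_eval_gaussianMeasure hA, ← h1,
      integral_map (by fun_prop) (by fun_prop)]
  · rw [← integral_eval_mul_eval_gaussianMeasure hD, ← h2,
      integral_map (by fun_prop) (by fun_prop)]

lemma sq_inner_sub_inner_eq {ι κ : Type*} [Fintype ι] [Fintype κ] (p q : (ι → ℝ) × (κ → ℝ)) :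
    ((p.1 ⬝ᵥ q.1) - (p.2 ⬝ᵥ q.2)) ^ 2 =
      (∑ i, (Sum.elim 1 (-1) : ι ⊕ κ → ℝ) i * (Sum.elim p.1 p.2 i * Sum.elim q.1 q.2 i)) ^ 2 := by
  simp [dotProduct, sub_eq_add_neg]

lemma integrable_cost [SFinite γ] (hA : A.PosDef) (hD : D.PosDef)
    (h1 : γ.map Prod.fst = gaussianMeasure A) (h2 : γ.map Prod.snd = gaussianMeasure D) :
    Integrable (fun pq : ((ι → ℝ) × (κ → ℝ)) × ((ι → ℝ) × (κ → ℝ)) =>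
      ((pq.1.1 ⬝ᵥ pq.2.1) - (pq.1.2 ⬝ᵥ pq.2.2)) ^ 2) (γ.prod γ) := by
  simp only [sq_inner_sub_inner_eq]
  exact integrable_sq_weighted_inner (memLp_two_of_marginals hA hD h1 h2) _

lemma integral_cost [SFinite γ] (hA : A.PosDef) (hD : D.PosDef)
    (h1 : γ.map Prod.fst = gaussianMeasure A) (h2 : γ.map Prod.snd = gaussianMeasure D) :
    ∫ p, ∫ q, ((p.1 ⬝ᵥ q.1) - (p.2 ⬝ᵥ q.2)) ^ 2 ∂γ ∂γ =
      ∑ i, ∑ j, A i j ^ 2 + ∑ i, ∑ j, D i j ^ 2 - 2 * ∑ i, ∑ j, crossCovariance γ i j ^ 2 := by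
  simp only [sq_inner_sub_inner_eq]
  rw [integral_sq_weighted_inner (memLp_two_of_marginals hA hD h1 h2) _ _
    (integral_coord_mul_coord hA hD h1 h2)]
  simp only [Fintype.sum_sum_type, Sum.elim_inl, Sum.elim_inr, fromBlocks_apply₁₁,
    fromBlocks_apply₁₂, fromBlocks_apply₂₁, fromBlocks_apply₂₂, transpose_apply,
    Finset.sum_add_distrib, Pi.one_apply, Pi.neg_apply, one_mul, mul_one, neg_mul, mul_neg,
    Finset.sum_neg_distrib]
  rw [Finset.sum_comm (s := (Finset.univ : Finset κ)) (t := (Finset.univ : Finset ι))]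
  ring

lemma gaussianMeasure_hyperplane {S : Matrix ι ι ℝ} (w : ι → ℝ) (hw : w ≠ 0) :
    gaussianMeasure S {z | w ⬝ᵥ z = 0} = 0 := by
  refine withDensity_absolutelyContinuous _ _ ?_
  have h := Measure.addHaar_submodule (volume : Measure (ι → ℝ))
    (LinearMap.ker (dotProductBilin ℝ ℝ w)) ?_
  · exact h
  · intro h
    refine hw (dotProduct_self_eq_zero.1 ?_)
    have : w ∈ LinearMap.ker (dotProductBilin ℝ ℝ w) := h ▸ Submodule.mem_top
    exact this

lemma posDef_covariance_of_absolutelyContinuous [IsProbabilityMeasure γ] (hA : A.PosDef)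
    (hD : D.PosDef) (h1 : γ.map Prod.fst = gaussianMeasure A)
    (h2 : γ.map Prod.snd = gaussianMeasure D)
    (hac : γ ≪ (gaussianMeasure A).prod (gaussianMeasure D)) :
    (fromBlocks A (crossCovariance γ) (crossCovariance γ)ᵀ D).PosDef := by
  refine posDef_of_second_moment (memLp_two_of_marginals hA hD h1 h2) _
    (integral_coord_mul_coord hA hD h1 h2) fun w hw h => ?_
  have hmeas : MeasurableSet {p : (ι → ℝ) × (κ → ℝ) | w ⬝ᵥ Sum.elim p.1 p.2 = 0} := by
    refine measurableSet_eq_fun ?_ measurable_const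
    simp only [dotProduct, Fintype.sum_sum_type, Sum.elim_inl, Sum.elim_inr]
    fun_prop
  have hzero : γ {p | w ⬝ᵥ Sum.elim p.1 p.2 = 0} = 0 := by
    refine hac ?_
    rw [← gaussianMeasure_fromBlocks_zero_map hA hD (posDef_fromBlocks_zero hA hD),
      Measure.map_apply (sumPiToProd ι κ).continuous.measurable hmeas]
    convert gaussianMeasure_hyperplane (S := fromBlocks A 0 0 D) w hw using 3 with z
    simp [sumPiToProd, dotProduct]
  have hfalse : ∀ᵐ p ∂γ, False := by
    filter_upwards [h, measure_eq_zero_iff_ae_notMem.1 hzero] with p hp hp'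
    exact hp' hp
  exact absurd hfalse (by simp [IsProbabilityMeasure.ne_zero γ])

lemma measurable_gaussianLogRatio_sumElim (S T : Matrix (ι ⊕ κ) (ι ⊕ κ) ℝ) :
    Measurable fun p : (ι → ℝ) × (κ → ℝ) => gaussianLogRatio S T (Sum.elim p.1 p.2) :=
  (measurable_gaussianLogRatio S T).comp (measurable_sumElim ι κ)

/-- Among couplings with a given cross-covariance, the Gaussian one minimizes relative entropy. -/
lemma neg_log_det_div_le_KLgen [IsProbabilityMeasure γ] (hA : A.PosDef)
    (hD : D.PosDef) (h1 : γ.map Prod.fst = gaussianMeasure A)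
    (h2 : γ.map Prod.snd = gaussianMeasure D)
    (hac : γ ≪ (gaussianMeasure A).prod (gaussianMeasure D))
    (hllr : Integrable (llr γ ((gaussianMeasure A).prod (gaussianMeasure D))) γ) :
    - Real.log ((fromBlocks A (crossCovariance γ) (crossCovariance γ)ᵀ D).det /
      (fromBlocks A 0 0 D).det) / 2 ≤ KLgen γ ((gaussianMeasure A).prod (gaussianMeasure D)) := by
  have hC := posDef_covariance_of_absolutelyContinuous hA hD h1 h2 hac
  have hZ := memLp_two_of_marginals hA hD h1 h2
  have := isProbabilityMeasure_gaussianMeasure hA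
  have := isProbabilityMeasure_gaussianMeasure hD
  have := isProbabilityMeasure_gaussianMeasure hC
  have := Measure.isProbabilityMeasure_map (μ := gaussianMeasure
    (fromBlocks A (crossCovariance γ) (crossCovariance γ)ᵀ D))
    (sumPiToProd ι κ).continuous.measurable.aemeasurable
  rw [← integral_gaussianLogRatio hZ _ _ hC (integral_coord_mul_coord hA hD h1 h2)
    (trace_inv_fromBlocks_zero_mul hA hD _)]
  exact integral_le_KLgen (measurable_gaussianLogRatio_sumElim _ _)
    (gaussianMeasure_map_eq_prod_withDensity hA hD hC) hac hllr (integrable_gaussianLogRatio hZ _ _)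

section GaussianJoint

variable {K : Matrix ι κ ℝ}

lemma crossCovariance_gaussianMeasure_map (hS : (fromBlocks A K Kᵀ D).PosDef) :
    crossCovariance ((gaussianMeasure (fromBlocks A K Kᵀ D)).map (sumPiToProd ι κ)) = K := by
  ext i j
  rw [crossCovariance, of_apply, integral_map
    (sumPiToProd ι κ).continuous.measurable.aemeasurable (by fun_prop)]
  exact integral_eval_mul_eval_gaussianMeasure hS (Sum.inl i) (Sum.inr j)

lemma integrable_llr_gaussianMeasure_map (hA : A.PosDef) (hD : D.PosDef)
    (hS : (fromBlocks A K Kᵀ D).PosDef) :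
    Integrable (llr ((gaussianMeasure (fromBlocks A K Kᵀ D)).map (sumPiToProd ι κ))
      ((gaussianMeasure A).prod (gaussianMeasure D)))
      ((gaussianMeasure (fromBlocks A K Kᵀ D)).map (sumPiToProd ι κ)) := by
  have := isProbabilityMeasure_gaussianMeasure hA
  have := isProbabilityMeasure_gaussianMeasure hD
  have := isProbabilityMeasure_gaussianMeasure hS
  have := Measure.isProbabilityMeasure_map (μ := gaussianMeasure (fromBlocks A K Kᵀ D))
    (sumPiToProd ι κ).continuous.measurable.aemeasurable
  exact (integrable_gaussianLogRatio (memLp_two_of_marginals hA hD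
    (gaussianMeasure_fromBlocks_map_fst hA hS) (gaussianMeasure_fromBlocks_map_snd hD hS)) _ _).congr
    (llr_withDensity_exp (measurable_gaussianLogRatio_sumElim _ _)
      (gaussianMeasure_map_eq_prod_withDensity hA hD hS)).symm

lemma KLgen_gaussianMeasure_map (hA : A.PosDef) (hD : D.PosDef)
    (hS : (fromBlocks A K Kᵀ D).PosDef) :
    KLgen ((gaussianMeasure (fromBlocks A K Kᵀ D)).map (sumPiToProd ι κ))
      ((gaussianMeasure A).prod (gaussianMeasure D)) =
      - Real.log ((fromBlocks A K Kᵀ D).det / (fromBlocks A 0 0 D).det) / 2 := by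
  have := isProbabilityMeasure_gaussianMeasure hA
  have := isProbabilityMeasure_gaussianMeasure hD
  have := isProbabilityMeasure_gaussianMeasure hS
  have := Measure.isProbabilityMeasure_map (μ := gaussianMeasure (fromBlocks A K Kᵀ D))
    (sumPiToProd ι κ).continuous.measurable.aemeasurable
  have h1 := gaussianMeasure_fromBlocks_map_fst hA hS
  have h2 := gaussianMeasure_fromBlocks_map_snd hD hS
  have hC := integral_coord_mul_coord hA hD h1 h2
  rw [crossCovariance_gaussianMeasure_map hS] at hC
  rw [KLgen_withDensity_exp (measurable_gaussianLogRatio_sumElim _ _)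
    (gaussianMeasure_map_eq_prod_withDensity hA hD hS)]
  exact integral_gaussianLogRatio (memLp_two_of_marginals hA hD h1 h2) _ _ hS hC
    (trace_inv_fromBlocks_zero_mul hA hD K)

end GaussianJoint

end GaussianCoupling

section OptimalCoupling

variable {m n : ℕ}

/-- The rectangular diagonal matrix with prescribed diagonal. -/
def rectDiagonal (m : ℕ) (d : Fin n → ℝ) : Matrix (Fin m) (Fin n) ℝ :=
  of fun i j => if (i : ℕ) = (j : ℕ) then d j else 0

lemma sum_rectDiagonal_mul (hmn : n ≤ m) (d : Fin n → ℝ) (f : Fin m → ℝ) (j : Fin n) :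
    ∑ i, rectDiagonal m d i j * f i = d j * f (Fin.castLE hmn j) := by
  rw [Finset.sum_eq_single (Fin.castLE hmn j)]
  · simp [rectDiagonal]
  · intro i _ hi
    have : (i : ℕ) ≠ j := fun h => hi (Fin.ext h)
    simp [rectDiagonal, this]
  · simp

lemma sum_sq_rectDiagonal (hmn : n ≤ m) (d : Fin n → ℝ) :
    ∑ i, ∑ j, rectDiagonal m d i j ^ 2 = ∑ j, d j ^ 2 := by
  rw [Finset.sum_comm]
  refine Finset.sum_congr rfl fun j _ => ?_
  simp only [sq]
  rw [sum_rectDiagonal_mul hmn]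
  simp [rectDiagonal]

lemma rectDiagonal_schur (hmn : n ≤ m) (a : Fin m → ℝ) (b d : Fin n → ℝ) :
    diagonal b - (rectDiagonal m d)ᵀ * diagonal a⁻¹ * rectDiagonal m d =
      diagonal fun j => b j - d j ^ 2 / a (Fin.castLE hmn j) := by
  ext j k
  have h : ((rectDiagonal m d)ᵀ * diagonal a⁻¹ * rectDiagonal m d) j k =
      d j * ((a (Fin.castLE hmn j))⁻¹ * rectDiagonal m d (Fin.castLE hmn j) k) := by
    rw [Matrix.mul_assoc, mul_apply]
    simp only [diagonal_mul, transpose_apply]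
    rw [sum_rectDiagonal_mul hmn]
    rfl
  rw [Matrix.sub_apply, h, diagonal_apply, diagonal_apply]
  by_cases hjk : j = k
  · subst hjk
    simp [rectDiagonal]
    ring
  · have : (j : ℕ) ≠ k := fun h => hjk (Fin.ext h)
    simp [rectDiagonal, hjk, this]

lemma inv_diagonal_of_pos {a : Fin m → ℝ} (ha : ∀ i, 0 < a i) :
    (diagonal a)⁻¹ = diagonal a⁻¹ :=
  inv_eq_right_inv (by simp [diagonal_mul_diagonal, mul_inv_cancel₀ (ha _).ne'])

lemma det_fromBlocks_rectDiagonal (hmn : n ≤ m) (a : Fin m → ℝ) (b d : Fin n → ℝ)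
    (ha : ∀ i, 0 < a i) :
    (fromBlocks (diagonal a) (rectDiagonal m d) (rectDiagonal m d)ᵀ (diagonal b)).det =
      (∏ i, a i) * ∏ j, (b j - d j ^ 2 / a (Fin.castLE hmn j)) := by
  let := (PosDef.diagonal ha).isUnit.invertible
  rw [det_fromBlocks₁₁, invOf_eq_nonsing_inv, inv_diagonal_of_pos ha,
    rectDiagonal_schur hmn, det_diagonal, det_diagonal]

lemma posDef_fromBlocks_rectDiagonal (hmn : n ≤ m) (a : Fin m → ℝ) (b d : Fin n → ℝ)
    (ha : ∀ i, 0 < a i) (hd : ∀ j, 0 < b j - d j ^ 2 / a (Fin.castLE hmn j)) :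
    (fromBlocks (diagonal a) (rectDiagonal m d) (rectDiagonal m d)ᵀ (diagonal b)).PosDef := by
  let := (PosDef.diagonal ha).isUnit.invertible
  have h := ((PosDef.diagonal ha).fromBlocks₁₁ (rectDiagonal m d) (diagonal b)).2 (by
    rw [conjTranspose_eq_transpose_of_trivial, inv_diagonal_of_pos ha,
      rectDiagonal_schur hmn]
    exact PosSemidef.diagonal fun j => (hd j).le)
  rw [conjTranspose_eq_transpose_of_trivial] at h
  rw [h.posDef_iff_det_ne_zero, det_fromBlocks_rectDiagonal hmn a b d ha]
  exact mul_ne_zero (Finset.prod_pos fun i _ => ha i).ne' (Finset.prod_pos fun j _ => hd j).ne'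

/-- The squared cross-covariance entry saturating the scalar trade-off. -/
lemma mul_max_one_sub_div {x ε : ℝ} (hx : 0 < x) :
    x * max (1 - ε / (4 * x)) 0 = max (x - ε / 4) 0 := by
  rw [mul_max_of_nonneg _ _ hx.le, mul_zero]
  congr 1
  field_simp

lemma log_one_sub_max_div {x ε : ℝ} (hx : 0 < x) (hε : 0 < ε) :
    Real.log (1 - max (x - ε / 4) 0 / x) = - max (Real.log x - Real.log (ε / 4)) 0 := by
  have hε4 : 0 < ε / 4 := by positivity
  rcases le_total x (ε / 4) with h | h
  · rw [max_eq_right (sub_nonpos.2 h), max_eq_right (sub_nonpos.2 (Real.log_le_log hx h))]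
    simp
  · rw [max_eq_left (sub_nonneg.2 h), max_eq_left (sub_nonneg.2 (Real.log_le_log hε4 h)),
      show 1 - (x - ε / 4) / x = ε / 4 / x by field_simp; ring, Real.log_div hε4.ne' hx.ne']
    ring

lemma max_sub_lt {x ε : ℝ} (hx : 0 < x) (hε : 0 < ε) : max (x - ε / 4) 0 < x :=
  max_lt (by linarith) hx

/-- The log-determinant term at the optimal cross-covariance. -/
lemma log_det_optimal (hmn : n ≤ m) (a : Fin m → ℝ) (b d : Fin n → ℝ)
    (ha : ∀ i, 0 < a i) (hb : ∀ j, 0 < b j) {ε : ℝ} (hε : 0 < ε)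
    (hd : ∀ j, d j ^ 2 = max (a (Fin.castLE hmn j) * b j - ε / 4) 0) :
    Real.log ((fromBlocks (diagonal a) (rectDiagonal m d) (rectDiagonal m d)ᵀ (diagonal b)).det /
      (fromBlocks (diagonal a) 0 0 (diagonal b)).det) =
      - ∑ j, max (Real.log (a (Fin.castLE hmn j) * b j) - Real.log (ε / 4)) 0 := by
  have hx : ∀ j, 0 < a (Fin.castLE hmn j) * b j := fun j => mul_pos (ha _) (hb _)
  have hb' : ∏ j, b j ≠ 0 := (Finset.prod_pos fun j _ => hb j).ne'
  have hfac : ∀ j, b j - d j ^ 2 / a (Fin.castLE hmn j) = b j *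
      (1 - max (a (Fin.castLE hmn j) * b j - ε / 4) 0 / (a (Fin.castLE hmn j) * b j)) := fun j => by
    rw [hd]
    have := (ha (Fin.castLE hmn j)).ne'
    have := (hb j).ne'
    field_simp
  rw [det_fromBlocks_rectDiagonal hmn a b d ha, det_fromBlocks_zero₂₁, det_diagonal, det_diagonal,
    mul_div_mul_left _ _ (Finset.prod_pos fun i _ => ha i).ne', Finset.prod_congr rfl fun j _ =>
    hfac j, Finset.prod_mul_distrib, mul_div_cancel_left₀ _ hb', Real.log_prod,
    ← Finset.sum_neg_distrib]
  · exact Finset.sum_congr rfl fun j _ => log_one_sub_max_div (hx j) hε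
  · intro j _
    have := (div_lt_one (hx j)).2 (max_sub_lt (hx j) hε)
    linarith

end OptimalCoupling

/-- closed form of the entropic inner-product Gromov–Wasserstein problem
between the centered Gaussians `μ = N(0, diag lμ)` on `ℝ^m` and `ν = N(0, diag lν)` on `ℝ^n`
(`m ≥ n ≥ 1`, positive non-increasing diagonal entries).  The infimum over couplings of
`E[(⟨X,X'⟩ - ⟨Y,Y'⟩)²] + ε KL(γ‖μ⊗ν)` equals
`tr(Sμ²) + tr(Sν²) - 2 ∑ₖ [lμ_k lν_k - ε/4]⁺ + (ε/2) ∑ₖ [log(lμ_k lν_k) - log(ε/4)]⁺`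
and is attained by the Gaussian coupling `N(0, [[Sμ, K*],[K*ᵀ, Sν]])` with
`K*` diagonal with entries `(lμ_k lν_k [1 - ε/(4 lμ_k lν_k)]⁺)^{1/2}`. -/
theorem entropic_IGW_gaussian_closed_form
    (m n : ℕ) (hn : 1 ≤ n) (hmn : n ≤ m)
    (lμ : Fin m → ℝ) (lν : Fin n → ℝ)
    (hlμpos : ∀ i, 0 < lμ i) (hlνpos : ∀ j, 0 < lν j)
    (hlμmono : ∀ i j : Fin m, i ≤ j → lμ j ≤ lμ i)
    (hlνmono : ∀ i j : Fin n, i ≤ j → lν j ≤ lν i)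
    (ε : ℝ) (hε : 0 < ε) :
    let Sμ : Matrix (Fin m) (Fin m) ℝ := Matrix.diagonal lμ
    let Sν : Matrix (Fin n) (Fin n) ℝ := Matrix.diagonal lν
    let μ : Measure (Fin m → ℝ) := gaussianMeasure Sμ
    let ν : Measure (Fin n → ℝ) := gaussianMeasure Sν
    -- the objective `E_{γ⊗γ}[(⟨X,X'⟩-⟨Y,Y'⟩)²] + ε KL(γ‖μ⊗ν)`
    let obj : Measure ((Fin m → ℝ) × (Fin n → ℝ)) → ℝ := fun γ =>
      (∫ p, ∫ q, ((p.1 ⬝ᵥ q.1) - (p.2 ⬝ᵥ q.2)) ^ 2 ∂γ ∂γ) + ε * KLgen γ (μ.prod ν)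
    -- admissible couplings: probability measures with marginals `μ`, `ν` for which the
    -- objective is honestly defined (finite cost and finite relative entropy)
    let adm : Set (Measure ((Fin m → ℝ) × (Fin n → ℝ))) :=
      {γ | IsProbabilityMeasure γ ∧ γ.map Prod.fst = μ ∧ γ.map Prod.snd = ν ∧
        γ ≪ μ.prod ν ∧
        Integrable (fun x => Real.log ((γ.rnDeriv (μ.prod ν) x).toReal)) γ ∧
        Integrable (fun pq : ((Fin m → ℝ) × (Fin n → ℝ)) × ((Fin m → ℝ) × (Fin n → ℝ)) =>
          ((pq.1.1 ⬝ᵥ pq.2.1) - (pq.1.2 ⬝ᵥ pq.2.2)) ^ 2) (γ.prod γ)}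
    let Kstar : Matrix (Fin m) (Fin n) ℝ :=
      Matrix.of fun i j => if (i : ℕ) = (j : ℕ) then
        Real.sqrt (lμ i * lν j * max (1 - ε / (4 * lμ i * lν j)) 0) else 0
    let γstar : Measure ((Fin m → ℝ) × (Fin n → ℝ)) :=
      (gaussianMeasure (Matrix.fromBlocks Sμ Kstar Kstarᵀ Sν)).map
        (MeasurableEquiv.sumPiEquivProdPi (fun _ => ℝ))
    let RHS : ℝ :=
      Matrix.trace (Sμ * Sμ) + Matrix.trace (Sν * Sν)
        - 2 * ∑ k : Fin n, max (lμ (Fin.castLE hmn k) * lν k - ε / 4) 0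
        + (ε / 2) * ∑ k : Fin n,
            max (Real.log (lμ (Fin.castLE hmn k) * lν k) - Real.log (ε / 4)) 0
    γstar ∈ adm ∧ obj γstar = RHS ∧ ∀ γ ∈ adm, RHS ≤ obj γ := by
  intro Sμ Sν μ ν obj adm Kstar γstar RHS
  have hμ : Sμ.PosDef := PosDef.diagonal hlμpos
  have hν : Sν.PosDef := PosDef.diagonal hlνpos
  have hsq : ∀ {k : ℕ} (d : Fin k → ℝ),
      ∑ i, ∑ j, (diagonal d : Matrix (Fin k) (Fin k) ℝ) i j ^ 2 =
        trace ((diagonal d : Matrix (Fin k) (Fin k) ℝ) * diagonal d) := fun d => by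
    simp [diagonal_apply, ite_pow, trace_diagonal, sq]
  set d : Fin n → ℝ := fun j => Real.sqrt (lμ (Fin.castLE hmn j) * lν j *
    max (1 - ε / (4 * lμ (Fin.castLE hmn j) * lν j)) 0) with hd_def
  have hK : Kstar = rectDiagonal m d := by
    ext i j
    simp only [Kstar, rectDiagonal, of_apply]
    split_ifs with hij
    · rw [show i = Fin.castLE hmn j from Fin.ext hij]
    · rfl
  have hx : ∀ j, 0 < lμ (Fin.castLE hmn j) * lν j := fun j => mul_pos (hlμpos _) (hlνpos _)
  have hd : ∀ j, d j ^ 2 = max (lμ (Fin.castLE hmn j) * lν j - ε / 4) 0 := fun j => by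
    rw [hd_def, Real.sq_sqrt (mul_nonneg (hx j).le (le_max_right _ _)), mul_assoc 4,
      mul_max_one_sub_div (hx j)]
  have hS : (fromBlocks Sμ Kstar Kstarᵀ Sν).PosDef := by
    rw [hK]
    refine posDef_fromBlocks_rectDiagonal hmn lμ lν d hlμpos fun j => ?_
    rw [hd, sub_pos, div_lt_iff₀ (hlμpos _), mul_comm (lν j)]
    exact max_sub_lt (hx j) hε
  have := isProbabilityMeasure_gaussianMeasure hS
  have hγ : γstar = (gaussianMeasure (fromBlocks Sμ Kstar Kstarᵀ Sν)).map
    (sumPiToProd (Fin m) (Fin n)) := rfl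
  have hprob : IsProbabilityMeasure γstar := Measure.isProbabilityMeasure_map
    (sumPiToProd (Fin m) (Fin n)).continuous.measurable.aemeasurable
  have h1 : γstar.map Prod.fst = μ := gaussianMeasure_fromBlocks_map_fst hμ hS
  have h2 : γstar.map Prod.snd = ν := gaussianMeasure_fromBlocks_map_snd hν hS
  refine ⟨⟨hprob, h1, h2, ?_, integrable_llr_gaussianMeasure_map hμ hν hS,
    integrable_cost hμ hν h1 h2⟩, ?_, ?_⟩
  · rw [hγ, gaussianMeasure_map_eq_prod_withDensity hμ hν hS]
    exact withDensity_absolutelyContinuous _ _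
  · have hKL : KLgen γstar (μ.prod ν) = _ := KLgen_gaussianMeasure_map hμ hν hS
    have hdet := log_det_optimal hmn lμ lν d hlμpos hlνpos hε hd
    rw [← hK] at hdet
    rw [hdet] at hKL
    have hcost := integral_cost hμ hν h1 h2
    have hcross : crossCovariance γstar = Kstar := crossCovariance_gaussianMeasure_map hS
    rw [hsq, hsq, hcross, hK, sum_sq_rectDiagonal hmn,
      Finset.sum_congr rfl fun j _ => hd j] at hcost
    simp only [obj, RHS]
    rw [hcost, hKL]
    ring
  · rintro γ ⟨hγprob, hγ1, hγ2, hac, hllr, -⟩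
    have hKL := neg_log_det_div_le_KLgen hμ hν hγ1 hγ2 hac hllr
    have hcost := integral_cost hμ hν hγ1 hγ2
    rw [hsq, hsq] at hcost
    have hcov := covariance_objective_le hmn lμ lν (fun i j h => hlμmono i j h) hlμpos
      (fun i j h => hlνmono i j h) hlνpos hε _
      (posDef_covariance_of_absolutelyContinuous hμ hν hγ1 hγ2 hac)
    simp only [obj, RHS]
    rw [hcost]
    have := mul_le_mul_of_nonneg_left hKL hε.le
    simp only [Sμ, Sν, μ, ν] at *
    linarith
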